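/- arXiv:1405.7582 — 4 statements merged into one kernel-verified Lean document; each statement's English description precedes it below -/
import Mathlib

section
/- Every primitive monoid is a tame refinement monoid. That is, for any set D equipped with a transitive antisymmetric relation ◁, the commutative monoid M(D, ◁) presented by the generating set D and the relations e + f = f for all e, f ∈ D with e ◁ f is a tame refinement monoid. -/
/-- A commutative monoid satisfies the Riesz refinement property if every equation
`x1 + x2 = y1 + y2` admits a refinement matrix. -/
def IsRefinementAddMonoid (M : Type*) [AddCommMonoid M] : Prop :=
  ∀ x1 x2 y1 y2 : M, x1 + x2 = y1 + y2 →
    ∃ z11 z12 z21 z22 : M,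
      x1 = z11 + z12 ∧ x2 = z21 + z22 ∧ y1 = z11 + z21 ∧ y2 = z12 + z22

/-- The algebraic (minimal) ordering on a commutative monoid: `x ≤ y` iff `x + z = y`
for some `z`. -/
def AlgLE {M : Type*} [AddCommMonoid M] (x y : M) : Prop := ∃ z, x + z = y

/-- A witness that the inclusion of the submonoid `S` into `M` factors through a
finitely generated refinement monoid. -/
structure TameWitness (M : Type*) [AddCommMonoid M] (S : AddSubmonoid M) where
  N : Type
  [instN : AddCommMonoid N]
  fg : AddMonoid.FG N
  refinement : IsRefinementAddMonoid N
  f : ↥S →+ N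
  g : N →+ M
  factors : ∀ s : ↥S, g (f s) = (s : M)

/-- A (refinement) monoid is tame if for each finitely generated submonoid `S ⊆ M`, the
inclusion map `S → M` factors through a finitely generated refinement monoid. -/
def IsTame (M : Type*) [AddCommMonoid M] : Prop :=
  ∀ S : AddSubmonoid M, S.FG → Nonempty (TameWitness M S)

/-- The defining congruence of the primitive monoid `M(D, ◁)`: the smallest congruence on
the free commutative monoid on `D` identifying `e + f` with `f` whenever `e ◁ f`. -/
noncomputable def primitiveCon (D : Type*) (rel : D → D → Prop) : AddCon (D →₀ ℕ) :=
  addConGen (fun u v => ∃ e f : D, rel e f ∧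
    u = Finsupp.single e 1 + Finsupp.single f 1 ∧ v = Finsupp.single f 1)

section PrimitiveAux

/-- `a` lies below some element of the support of `u`. -/
def PUp {D : Type*} (rel : D → D → Prop) (u : D →₀ ℕ) (a : D) : Prop :=
  ∃ f, u f ≠ 0 ∧ rel a f

theorem pUp_add {D : Type*} (rel : D → D → Prop) (u v : D →₀ ℕ) (a : D) :
    PUp rel (u + v) a ↔ PUp rel u a ∨ PUp rel v a := by
  unfold PUp
  constructor
  · rintro ⟨f, hf, h⟩
    by_cases h0 : u f = 0
    · right
      refine ⟨f, ?_, h⟩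
      intro h1
      simp [h0, h1] at hf
    · exact Or.inl ⟨f, h0, h⟩
  · rintro (⟨f, hf, h⟩ | ⟨f, hf, h⟩)
    · exact ⟨f, by simp only [Finsupp.add_apply]; omega, h⟩
    · exact ⟨f, by simp only [Finsupp.add_apply]; omega, h⟩

theorem pUp_single {D : Type*} (rel : D → D → Prop) (e a : D) :
    PUp rel (Finsupp.single e 1) a ↔ rel a e := by
  unfold PUp
  constructor
  · rintro ⟨f, hf, h⟩
    by_cases h0 : e = f
    · subst h0; exact h
    · simp [Finsupp.single_apply, h0] at hf
  · intro h
    exact ⟨e, by simp, h⟩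

/-- Explicit description of the congruence. -/
def pCon {D : Type*} (rel : D → D → Prop) : AddCon (D →₀ ℕ) where
  r u v := ∀ a, (PUp rel u a ↔ PUp rel v a) ∧ (¬ PUp rel u a → u a = v a)
  iseqv := by
    refine ⟨fun u a => ⟨Iff.rfl, fun _ => rfl⟩, fun {u v} h a => ?_, fun {u v w} h k a => ?_⟩
    · exact ⟨(h a).1.symm, fun hn => ((h a).2 (fun hu => hn ((h a).1.1 hu))).symm⟩
    · exact ⟨(h a).1.trans (k a).1, fun hn =>
        ((h a).2 hn).trans ((k a).2 (fun hv => hn ((h a).1.2 hv)))⟩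
  add' := by
    intro u v w z h k a
    refine ⟨?_, fun hn => ?_⟩
    · rw [pUp_add, pUp_add, (h a).1, (k a).1]
    · rw [pUp_add, not_or] at hn
      rw [Finsupp.add_apply, Finsupp.add_apply, (h a).2 hn.1, (k a).2 hn.2]

theorem primitiveCon_le {D : Type*} (rel : D → D → Prop) (htrans : Transitive rel) :
    primitiveCon D rel ≤ pCon rel := by
  unfold primitiveCon
  rw [AddCon.addConGen_le]
  rintro u v ⟨e, f, hef, rfl, rfl⟩
  intro a
  rw [pUp_add, pUp_single, pUp_single]
  refine ⟨⟨?_, Or.inr⟩, ?_⟩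
  · rintro (h | h)
    · exact htrans h hef
    · exact h
  · intro hn
    have : e ≠ a := by
      rintro rfl
      exact hn (Or.inr hef)
    simp [Finsupp.single_apply, this]

theorem primitiveCon_absorb_one {D : Type*} (rel : D → D → Prop) (u : D →₀ ℕ) (a : D)
    (h : PUp rel u a) : primitiveCon D rel (u + Finsupp.single a 1) u := by
  obtain ⟨f, hf, haf⟩ := h
  have hu : u = (u - Finsupp.single f 1) + Finsupp.single f 1 := by
    ext b
    by_cases hb : f = b
    · subst hb
      simp
      omega
    · simp [Finsupp.single_apply, hb]
  have h1 : primitiveCon D rel (Finsupp.single a 1 + Finsupp.single f 1) (Finsupp.single f 1) :=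
    AddConGen.Rel.of _ _ ⟨a, f, haf, rfl, rfl⟩
  have h2 := (primitiveCon D rel).add ((primitiveCon D rel).refl (u - Finsupp.single f 1)) h1
  rw [← hu] at h2
  have h3 : u + Finsupp.single a 1
      = (u - Finsupp.single f 1) + (Finsupp.single a 1 + Finsupp.single f 1) := by
    conv_lhs => rw [hu]
    rw [add_assoc, add_comm (Finsupp.single f 1)]
  rw [h3]
  exact h2

theorem primitiveCon_absorb {D : Type*} (rel : D → D → Prop) (u w : D →₀ ℕ)
    (h : ∀ a, w a ≠ 0 → PUp rel u a) : primitiveCon D rel (u + w) u := by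
  induction w using Finsupp.induction_linear with
  | zero => rw [add_zero]; exact (primitiveCon D rel).refl u
  | add w z hw hz =>
    have h1 := hw (fun a ha => h a (by simp only [Finsupp.add_apply]; omega))
    have h2 := hz (fun a ha => h a (by simp only [Finsupp.add_apply]; omega))
    have h3 := (primitiveCon D rel).add h1 ((primitiveCon D rel).refl z)
    rw [add_assoc] at h3
    exact (primitiveCon D rel).trans h3 h2
  | single a n =>
    induction n with
    | zero => simp only [Finsupp.single_zero, add_zero]; exact (primitiveCon D rel).refl u
    | succ n ih =>
      have hu : PUp rel u a := h a (by simp)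
      have h1 := ih (fun b hb => by
        by_cases hab : a = b
        · subst hab; exact hu
        · simp [Finsupp.single_apply, hab] at hb)
      have h3 := (primitiveCon D rel).add h1 ((primitiveCon D rel).refl (Finsupp.single a 1))
      rw [add_assoc, ← Finsupp.single_add] at h3
      exact (primitiveCon D rel).trans h3 (primitiveCon_absorb_one rel u a hu)

theorem pCon_sub {D : Type*} (rel : D → D → Prop) (u v : D →₀ ℕ) (h : pCon rel u v) :
    ∀ a, (v - u) a ≠ 0 → PUp rel u a := by
  intro a ha
  by_contra hn
  have := (h a).2 hn
  simp [this] at ha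

theorem add_tsub_symm {D : Type*} (u v : D →₀ ℕ) : u + (v - u) = v + (u - v) := by
  ext a
  simp only [Finsupp.add_apply, Finsupp.tsub_apply]
  omega

theorem primitiveCon_iff {D : Type*} (rel : D → D → Prop) (htrans : Transitive rel)
    (u v : D →₀ ℕ) : primitiveCon D rel u v ↔ pCon rel u v := by
  refine ⟨fun h => primitiveCon_le rel htrans h, fun h => ?_⟩
  have h1 := primitiveCon_absorb rel u (v - u) (pCon_sub rel u v h)
  have h2 := primitiveCon_absorb rel v (u - v) (pCon_sub rel v u ((pCon rel).symm h))
  rw [add_tsub_symm] at h1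
  exact (primitiveCon D rel).trans ((primitiveCon D rel).symm h1) h2

theorem finsupp_refine {D : Type*} (x1 x2 y1 y2 : D →₀ ℕ) (h : x1 + x2 = y1 + y2) :
    ∃ z11 z12 z21 z22 : D →₀ ℕ,
      x1 = z11 + z12 ∧ x2 = z21 + z22 ∧ y1 = z11 + z21 ∧ y2 = z12 + z22 := by
  have h' : ∀ a, x1 a + x2 a = y1 a + y2 a := fun a => by
    rw [← Finsupp.add_apply, h, Finsupp.add_apply]
  refine ⟨x1 - (x1 - y1), x1 - y1, y1 - x1, x2 - (y1 - x1), ?_, ?_, ?_, ?_⟩ <;>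
  · ext a
    have := h' a
    simp only [Finsupp.add_apply, Finsupp.tsub_apply]
    omega

theorem split_absorb {D : Type*} (rel : D → D → Prop) (x1 x2 w : D →₀ ℕ)
    (h : ∀ a, w a ≠ 0 → PUp rel (x1 + x2) a) :
    ∃ w1 w2, w1 + w2 = w ∧ primitiveCon D rel (x1 + w1) x1 ∧
      primitiveCon D rel (x2 + w2) x2 := by
  classical
  refine ⟨w.filter (PUp rel x1), w.filter (fun a => ¬ PUp rel x1 a),
    Finsupp.filter_pos_add_filter_neg _ _, ?_, ?_⟩
  · apply primitiveCon_absorb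
    intro a ha
    by_contra hn
    simp [Finsupp.filter_apply, hn] at ha
  · apply primitiveCon_absorb
    intro a ha
    rw [Finsupp.filter_apply] at ha
    split_ifs at ha with hn
    · exact absurd rfl ha
    · exact ((pUp_add rel x1 x2 a).1 (h a ha)).resolve_left hn

theorem primitive_refinement {D : Type*} (rel : D → D → Prop) (htrans : Transitive rel) :
    IsRefinementAddMonoid (primitiveCon D rel).Quotient := by
  intro X1 X2 Y1 Y2
  induction X1 using AddCon.induction_on with | _ x1 =>
  induction X2 using AddCon.induction_on with | _ x2 =>
  induction Y1 using AddCon.induction_on with | _ y1 =>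
  induction Y2 using AddCon.induction_on with | _ y2 =>
  intro h
  rw [← AddCon.coe_add, ← AddCon.coe_add, AddCon.eq, primitiveCon_iff rel htrans] at h
  obtain ⟨w1, w2, hw, hx1, hx2⟩ := split_absorb rel x1 x2 _ (pCon_sub rel _ _ h)
  obtain ⟨v1, v2, hv, hy1, hy2⟩ :=
    split_absorb rel y1 y2 _ (pCon_sub rel _ _ ((pCon rel).symm h))
  have key : (x1 + w1) + (x2 + w2) = (y1 + v1) + (y2 + v2) := by
    rw [add_add_add_comm, hw, add_add_add_comm, hv, add_tsub_symm]
  obtain ⟨z11, z12, z21, z22, e1, e2, e3, e4⟩ := finsupp_refine _ _ _ _ key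
  refine ⟨(z11 : (primitiveCon D rel).Quotient), z12, z21, z22, ?_, ?_, ?_, ?_⟩
  · rw [← AddCon.coe_add, ← e1]; exact ((AddCon.eq _).2 hx1).symm
  · rw [← AddCon.coe_add, ← e2]; exact ((AddCon.eq _).2 hx2).symm
  · rw [← AddCon.coe_add, ← e3]; exact ((AddCon.eq _).2 hy1).symm
  · rw [← AddCon.coe_add, ← e4]; exact ((AddCon.eq _).2 hy2).symm

theorem pUp_mapDomain {D E : Type*} (rel : D → D → Prop) (i : E → D)
    (hi : Function.Injective i) (u : E →₀ ℕ) (a : E) :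
    PUp rel (u.mapDomain i) (i a) ↔ PUp (fun x y => rel (i x) (i y)) u a := by
  constructor
  · rintro ⟨f, hf, h⟩
    by_cases hr : f ∈ Set.range i
    · obtain ⟨b, rfl⟩ := hr
      rw [Finsupp.mapDomain_apply hi] at hf
      exact ⟨b, hf, h⟩
    · exact absurd (Finsupp.mapDomain_notin_range _ _ hr) hf
  · rintro ⟨b, hb, h⟩
    exact ⟨i b, by rwa [Finsupp.mapDomain_apply hi], h⟩

/-- The map induced by a map of generating sets. -/
noncomputable def primMap {D E : Type*} (rel : D → D → Prop) (i : E → D) :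
    (primitiveCon E (fun x y => rel (i x) (i y))).Quotient →+ (primitiveCon D rel).Quotient :=
  AddCon.lift _ ((primitiveCon D rel).mk'.comp (Finsupp.mapDomain.addMonoidHom i)) (by
    unfold primitiveCon
    rw [AddCon.addConGen_le]
    rintro u v ⟨e, f, hef, rfl, rfl⟩
    rw [AddCon.ker_rel]
    simp only [AddMonoidHom.comp_apply, Finsupp.mapDomain.addMonoidHom_apply,
      Finsupp.mapDomain_add, Finsupp.mapDomain_single]
    exact (AddCon.eq _).2 (AddConGen.Rel.of _ _ ⟨i e, i f, hef, rfl, rfl⟩))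

theorem primMap_coe {D E : Type*} (rel : D → D → Prop) (i : E → D) (u : E →₀ ℕ) :
    primMap rel i (u : (primitiveCon E (fun x y => rel (i x) (i y))).Quotient)
      = ((u.mapDomain i : D →₀ ℕ) : (primitiveCon D rel).Quotient) := rfl

theorem primMap_injective {D E : Type*} (rel : D → D → Prop) (htrans : Transitive rel)
    (i : E → D) (hi : Function.Injective i) : Function.Injective (primMap rel i) := by
  intro U V
  induction U using AddCon.induction_on with | _ u =>
  induction V using AddCon.induction_on with | _ v =>
  intro h
  rw [primMap_coe, primMap_coe, AddCon.eq, primitiveCon_iff rel htrans] at h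
  have ht : Transitive (fun x y => rel (i x) (i y)) := fun a b c hab hbc => htrans hab hbc
  rw [AddCon.eq, primitiveCon_iff _ ht]
  intro a
  have ha := h (i a)
  rw [pUp_mapDomain rel i hi, pUp_mapDomain rel i hi, Finsupp.mapDomain_apply hi,
    Finsupp.mapDomain_apply hi] at ha
  exact ha

theorem primitive_isTame {D : Type*} (rel : D → D → Prop) (htrans : Transitive rel) :
    IsTame (primitiveCon D rel).Quotient := by
  classical
  intro S hS
  obtain ⟨T, hT⟩ := hS
  have hrep : ∀ t : (primitiveCon D rel).Quotient, ∃ u : D →₀ ℕ, (u : (primitiveCon D rel).Quotient) = t :=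
    fun t => AddCon.mk'_surjective t
  choose r hr using hrep
  let F : Finset D := T.biUnion (fun t => (r t).support)
  let i : Fin F.card → D := fun k => (F.equivFin.symm k : D)
  have hi : Function.Injective i := Subtype.val_injective.comp F.equivFin.symm.injective
  have hrange : Set.range i = F := by
    ext d
    constructor
    · rintro ⟨k, rfl⟩
      exact (F.equivFin.symm k).2
    · intro hd
      exact ⟨F.equivFin ⟨d, hd⟩, by simp [i]⟩
  have hle : S ≤ AddMonoidHom.mrange (primMap rel i) := by
    rw [← hT, AddSubmonoid.closure_le]
    intro t ht
    have hsup : ((r t).support : Set D) ⊆ Set.range i := by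
      rw [hrange]
      intro d hd
      exact Finset.mem_coe.2 (Finset.mem_biUnion.2 ⟨t, ht, hd⟩)
    refine ⟨(((r t).comapDomain i hi.injOn : Fin F.card →₀ ℕ) : (primitiveCon _ _).Quotient), ?_⟩
    rw [primMap_coe, Finsupp.mapDomain_comapDomain i hi _ hsup, hr]
  have hex : ∀ s : S, ∃ n, primMap rel i n = (s : (primitiveCon D rel).Quotient) :=
    fun s => hle s.2
  choose f hf using hex
  have hinj := primMap_injective rel htrans i hi
  haveI : AddMonoid.FG (Fin F.card →₀ ℕ) := Module.Finite.iff_addMonoid_fg.1 inferInstance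
  exact ⟨{
    N := (primitiveCon (Fin F.card) (fun x y => rel (i x) (i y))).Quotient
    fg := AddMonoid.fg_of_surjective (primitiveCon _ _).mk' AddCon.mk'_surjective
    refinement := primitive_refinement _ (fun a b c hab hbc => htrans hab hbc)
    f := { toFun := f
           map_zero' := hinj (by rw [hf, map_zero]; rfl)
           map_add' := fun a b => hinj (by rw [hf, map_add, hf, hf]; rfl) }
    g := primMap rel i
    factors := hf }⟩

end PrimitiveAux

/-- Every primitive monoid `M(D, ◁)` (for `◁` transitive and antisymmetric) is a tame
refinement monoid. -/
theorem primitive_tame (D : Type*) (rel : D → D → Prop)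
    (htrans : Transitive rel) (hanti : AntiSymmetric rel) :
    IsRefinementAddMonoid (primitiveCon D rel).Quotient ∧
    IsTame (primitiveCon D rel).Quotient := by
  exact ⟨primitive_refinement rel htrans, primitive_isTame rel htrans⟩
end

section
/- Let M0 be the commutative monoid presented by three generators x0, y0, z0 and the single relation x0 + y0 = x0 + z0. Then x0, y0, z0 are pairwise distinct irreducible elements of M0, y0 ≠ z0, and M0 is not a refinement monoid: the equation x0 + y0 = x0 + z0 admits no refinement in M0. -/
/-- A commutative monoid is conical if `x + y = 0` implies `x = y = 0`. -/
def IsConical (M : Type*) [AddCommMonoid M] : Prop :=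
  ∀ x y : M, x + y = 0 → x = 0 ∧ y = 0

/-- Stably finite: `x + y = x` implies `y = 0`. -/
def IsStablyFinite (M : Type*) [AddCommMonoid M] : Prop :=
  ∀ x y : M, x + y = x → y = 0

/-- Separative: `2x = 2y = x + y` implies `x = y`. -/
def IsSeparative (M : Type*) [AddCommMonoid M] : Prop :=
  ∀ x y : M, x + x = y + y → x + x = x + y → x = y

/-- Cancellative: `x + y = x + z` implies `y = z`. -/
def IsCancellative (M : Type*) [AddCommMonoid M] : Prop :=
  ∀ x y z : M, x + y = x + z → y = z

/-- Unperforated: `m x ≤ m y` implies `x ≤ y` (algebraic order), for positive `m`. -/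
def IsUnperforated (M : Type*) [AddCommMonoid M] : Prop :=
  ∀ (m : ℕ) (x y : M), 0 < m → AlgLE (m • x) (m • y) → AlgLE x y

/-- Antisymmetric: the algebraic ordering is antisymmetric. -/
def IsAntisymmetricMon (M : Type*) [AddCommMonoid M] : Prop :=
  ∀ x y : M, AlgLE x y → AlgLE y x → x = y

/-- Archimedean: if `n x ≤ y` for all positive `n`, then `x` is invertible. -/
def IsArchimedeanMon (M : Type*) [AddCommMonoid M] : Prop :=
  ∀ x y : M, (∀ n : ℕ, 0 < n → AlgLE (n • x) y) → IsAddUnit x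

/-- Riesz interpolation property. -/
def HasRieszInterpolation (M : Type*) [AddCommMonoid M] : Prop :=
  ∀ x1 x2 y1 y2 : M, AlgLE x1 y1 → AlgLE x1 y2 → AlgLE x2 y1 → AlgLE x2 y2 →
    ∃ z : M, AlgLE x1 z ∧ AlgLE x2 z ∧ AlgLE z y1 ∧ AlgLE z y2

/-- An element is irreducible if it is not invertible and whenever `x = a + b`,
either `a` or `b` is invertible. -/
def IsIrreducibleElem {M : Type*} [AddCommMonoid M] (x : M) : Prop :=
  ¬ IsAddUnit x ∧ ∀ a b : M, x = a + b → IsAddUnit a ∨ IsAddUnit b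

/-- The smallest congruence on the free commutative monoid on three generators
`x0, y0, z0` identifying `x0 + y0` with `x0 + z0`. -/
noncomputable def M0Con : AddCon (Fin 3 →₀ ℕ) :=
  addConGen (fun u v =>
    u = Finsupp.single 0 1 + Finsupp.single 1 1 ∧
    v = Finsupp.single 0 1 + Finsupp.single 2 1)

/-- `M0 = ⟨ x0, y0, z0 ∣ x0 + y0 = x0 + z0 ⟩`. -/
abbrev M0 : Type := M0Con.Quotient

noncomputable def x0 : M0 := M0Con.mk' (Finsupp.single 0 1)
noncomputable def y0 : M0 := M0Con.mk' (Finsupp.single 1 1)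
noncomputable def z0 : M0 := M0Con.mk' (Finsupp.single 2 1)

def m0deg (u : Fin 3 →₀ ℕ) : ℕ := u 0 + u 1 + u 2

theorem m0deg_add (u v : Fin 3 →₀ ℕ) : m0deg (u + v) = m0deg u + m0deg v := by
  simp only [m0deg, Finsupp.add_apply]; omega

/-- An auxiliary congruence containing `M0Con`. -/
def m0Aux : AddCon (Fin 3 →₀ ℕ) where
  r u v := u = v ∨ (m0deg u = m0deg v ∧ 2 ≤ m0deg u)
  iseqv := by
    refine ⟨fun _ => Or.inl rfl, ?_, ?_⟩
    · rintro u v (rfl | ⟨h, h2⟩)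
      · exact Or.inl rfl
      · right; omega
    · rintro u v w (rfl | ⟨h, h2⟩) (rfl | ⟨h3, h4⟩)
      · exact Or.inl rfl
      · right; omega
      · right; omega
      · right; omega
  add' := by
    rintro u v w x (rfl | ⟨h, h2⟩) (rfl | ⟨h3, h4⟩)
    · exact Or.inl rfl
    · right; simp only [m0deg_add]; omega
    · right; simp only [m0deg_add]; omega
    · right; simp only [m0deg_add]; omega

theorem m0Con_aux {u v : Fin 3 →₀ ℕ} (h : M0Con.mk' u = M0Con.mk' v) :
    u = v ∨ (m0deg u = m0deg v ∧ 2 ≤ m0deg u) := by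
  have h1 : M0Con u v := (AddCon.eq M0Con).1 h
  have h2 : M0Con ≤ m0Aux := by
    refine AddCon.addConGen_le.2 ?_
    rintro a b ⟨rfl, rfl⟩
    right
    simp [m0deg]
  exact h2 h1

theorem m0deg_zero {u : Fin 3 →₀ ℕ} (h : m0deg u = 0) : u = 0 := by
  ext i
  unfold m0deg at h
  fin_cases i <;> simp <;> omega

theorem m0_split {i : Fin 3} {a b : M0} (h : M0Con.mk' (Finsupp.single i 1) = a + b) :
    (a = 0 ∧ b = M0Con.mk' (Finsupp.single i 1)) ∨
    (b = 0 ∧ a = M0Con.mk' (Finsupp.single i 1)) := by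
  obtain ⟨u, rfl⟩ := AddCon.mk'_surjective a
  obtain ⟨v, rfl⟩ := AddCon.mk'_surjective b
  have hd : m0deg (Finsupp.single i 1) = 1 := by
    fin_cases i <;> simp [m0deg]
  have h' := h
  rw [← map_add] at h'
  have hs : m0deg u + m0deg v = 1 := by
    rw [← m0deg_add]
    rcases m0Con_aux h' with h1 | h1
    · rw [← h1, hd]
    · omega
  rcases Nat.eq_zero_or_pos (m0deg u) with h0 | h0
  · have := m0deg_zero h0
    subst this
    left
    refine ⟨map_zero _, ?_⟩
    rw [h, map_zero, zero_add]
  · have := m0deg_zero (u := v) (by omega)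
    subst this
    right
    refine ⟨map_zero _, ?_⟩
    rw [h, map_zero, add_zero]

theorem m0_gen_inj {i j : Fin 3}
    (h : M0Con.mk' (Finsupp.single i 1) = M0Con.mk' (Finsupp.single j 1)) : i = j := by
  have hd : m0deg (Finsupp.single i 1) = 1 := by
    fin_cases i <;> simp [m0deg]
  rcases m0Con_aux h with h1 | h1
  · exact Finsupp.single_left_injective one_ne_zero h1
  · omega

theorem m0_gen_ne_zero (i : Fin 3) : M0Con.mk' (Finsupp.single i 1) ≠ 0 := by
  intro h
  have hd : m0deg (Finsupp.single i 1) = 1 := by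
    fin_cases i <;> simp [m0deg]
  rw [← map_zero M0Con.mk'] at h
  rcases m0Con_aux h with h1 | h1
  · simp at h1
  · omega

theorem m0_irred (i : Fin 3) : IsIrreducibleElem (M0Con.mk' (Finsupp.single i 1) : M0) := by
  constructor
  · intro h
    obtain ⟨b, hb⟩ := h.exists_neg
    obtain ⟨u, rfl⟩ := AddCon.mk'_surjective b
    rw [← map_add, ← map_zero M0Con.mk'] at hb
    have hd : m0deg (Finsupp.single i 1) = 1 := by
      fin_cases i <;> simp [m0deg]
    have h0 : m0deg 0 = 0 := by simp [m0deg]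
    have hs := m0deg_add (Finsupp.single i 1) u
    rcases m0Con_aux hb with h1 | h1
    · rw [h1] at hs; omega
    · omega
  · intro a b h
    rcases m0_split h with ⟨rfl, _⟩ | ⟨rfl, _⟩
    · exact Or.inl isAddUnit_zero
    · exact Or.inr isAddUnit_zero

theorem m0_rel : x0 + y0 = x0 + z0 := by
  unfold x0 y0 z0
  rw [← map_add, ← map_add]
  exact (AddCon.eq M0Con).2 (AddConGen.Rel.of _ _ ⟨rfl, rfl⟩)

theorem m0_no_ref : ¬ ∃ z11 z12 z21 z22 : M0,
    x0 = z11 + z12 ∧ y0 = z21 + z22 ∧ x0 = z11 + z21 ∧ z0 = z12 + z22 := by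
  rintro ⟨a, b, c, d, h1, h2, h3, h4⟩
  rcases m0_split h1 with ⟨_, hb⟩ | ⟨hb, _⟩
  · rcases m0_split h4 with ⟨hb', _⟩ | ⟨_, hb'⟩
    · exact m0_gen_ne_zero _ (hb.symm.trans hb')
    · exact absurd (m0_gen_inj (hb.symm.trans hb')) (by decide)
  · subst hb
    rw [zero_add] at h4
    subst h4
    rcases m0_split h2 with ⟨_, h⟩ | ⟨h, _⟩
    · exact absurd (m0_gen_inj h) (by decide)
    · exact m0_gen_ne_zero _ h

/-- In `M0 = ⟨ x0, y0, z0 ∣ x0 + y0 = x0 + z0 ⟩`, the elements `x0, y0, z0` are pairwise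
distinct irreducible elements, and the equation `x0 + y0 = x0 + z0` admits no refinement;
in particular `M0` is not a refinement monoid. -/
theorem M0_irreducibles_and_no_refinement :
    IsIrreducibleElem x0 ∧ IsIrreducibleElem y0 ∧ IsIrreducibleElem z0 ∧
    x0 ≠ y0 ∧ x0 ≠ z0 ∧ y0 ≠ z0 ∧
    ¬ IsRefinementAddMonoid M0 ∧
    ¬ ∃ z11 z12 z21 z22 : M0,
        x0 = z11 + z12 ∧ y0 = z21 + z22 ∧ x0 = z11 + z21 ∧ z0 = z12 + z22 := by
  refine ⟨m0_irred 0, m0_irred 1, m0_irred 2, ?_, ?_, ?_, ?_, m0_no_ref⟩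
  · exact fun h => absurd (m0_gen_inj h) (by decide)
  · exact fun h => absurd (m0_gen_inj h) (by decide)
  · exact fun h => absurd (m0_gen_inj h) (by decide)
  · exact fun h => m0_no_ref (h _ _ _ _ m0_rel)
end

section
/- Let M be the commutative monoid presented by generators x0, y0, z0, a1, x1, y1, z1, a2, x2, y2, z2, ... and relations x0 + y0 = x0 + z0, y_l = y_{l+1} + a_{l+1}, z_l = z_{l+1} + a_{l+1}, and x_l = x_{l+1} + y_{l+1} = x_{l+1} + z_{l+1} for all l ≥ 0. Let n ≥ 0 and m, m', i, i', j, j', k_1, k'_1, ..., k_n, k'_n be nonnegative integers. Then m x_n + i y_n + j z_n + Σ_{l=1}^n k_l a_l = m' x_n + i' y_n + j' z_n + Σ_{l=1}^n k'_l a_l holds in M if and only if either (m = m' = 0, i = i', j = j', and k_l = k'_l for all l) or (m = m' > 0, i + j = i' + j', and k_l = k'_l for all l). -/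
/-- Generators of the free commutative monoid underlying the monoid `M` of Section 4:
`Sum.inl (0, l)`, `Sum.inl (1, l)`, `Sum.inl (2, l)` are `x_l`, `y_l`, `z_l` (for `l ≥ 0`),
and `Sum.inr l` is `a_{l+1}` (for `l ≥ 0`). -/
abbrev FreeGenM : Type := (Fin 3 × ℕ) ⊕ ℕ

/-- The free commutative monoid on the generators. -/
abbrev FreeMonM : Type := FreeGenM →₀ ℕ

/-- The generator `x_l`. -/
noncomputable def Xg (l : ℕ) : FreeMonM := Finsupp.single (Sum.inl (0, l)) 1
/-- The generator `y_l`. -/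
noncomputable def Yg (l : ℕ) : FreeMonM := Finsupp.single (Sum.inl (1, l)) 1
/-- The generator `z_l`. -/
noncomputable def Zg (l : ℕ) : FreeMonM := Finsupp.single (Sum.inl (2, l)) 1
/-- The generator `a_{l+1}` (so `Ag 0 = a_1`, `Ag 1 = a_2`, ...). -/
noncomputable def Ag (l : ℕ) : FreeMonM := Finsupp.single (Sum.inr l) 1

/-- The defining relations: `x0 + y0 = x0 + z0`, `y_l = y_{l+1} + a_{l+1}`,
`z_l = z_{l+1} + a_{l+1}`, `x_l = x_{l+1} + y_{l+1}`, `x_l = x_{l+1} + z_{l+1}`. -/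
def MRel : FreeMonM → FreeMonM → Prop := fun u v =>
  (u = Xg 0 + Yg 0 ∧ v = Xg 0 + Zg 0) ∨
  (∃ l, u = Yg l ∧ v = Yg (l + 1) + Ag l) ∨
  (∃ l, u = Zg l ∧ v = Zg (l + 1) + Ag l) ∨
  (∃ l, u = Xg l ∧ v = Xg (l + 1) + Yg (l + 1)) ∨
  (∃ l, u = Xg l ∧ v = Xg (l + 1) + Zg (l + 1))

/-- The smallest congruence containing the defining relations. -/
noncomputable def MCon : AddCon FreeMonM := addConGen MRel

/-- The monoid `M` of Section 4 of the paper. -/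
abbrev MonM : Type := MCon.Quotient

/-- The image of `x_l` in `M`. -/
noncomputable def xq (l : ℕ) : MonM := MCon.mk' (Xg l)
/-- The image of `y_l` in `M`. -/
noncomputable def yq (l : ℕ) : MonM := MCon.mk' (Yg l)
/-- The image of `z_l` in `M`. -/
noncomputable def zq (l : ℕ) : MonM := MCon.mk' (Zg l)
/-- The image of `a_{l+1}` in `M`. -/
noncomputable def aq (l : ℕ) : MonM := MCon.mk' (Ag l)

/-- Lift of a function on generators respecting the relations. -/
theorem MonM_exists_hom {N : Type} [AddCommMonoid N] (fx fy fz fa : ℕ → N)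
    (h0 : fx 0 + fy 0 = fx 0 + fz 0)
    (hy : ∀ l, fy l = fy (l + 1) + fa l) (hz : ∀ l, fz l = fz (l + 1) + fa l)
    (hxy : ∀ l, fx l = fx (l + 1) + fy (l + 1)) (hxz : ∀ l, fx l = fx (l + 1) + fz (l + 1)) :
    ∃ φ : MonM →+ N, (∀ l, φ (xq l) = fx l) ∧ (∀ l, φ (yq l) = fy l) ∧
      (∀ l, φ (zq l) = fz l) ∧ (∀ l, φ (aq l) = fa l) := by
  let g : FreeGenM → N := Sum.elim (fun p => ![fx p.2, fy p.2, fz p.2] p.1) fa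
  let ψ : FreeMonM →+ N := Finsupp.liftAddHom (fun t => (multiplesHom N) (g t))
  have ex : ∀ l, ψ (Xg l) = fx l := by intro l; simp [ψ, Xg, g]
  have ey : ∀ l, ψ (Yg l) = fy l := by intro l; simp [ψ, Yg, g]
  have ez : ∀ l, ψ (Zg l) = fz l := by intro l; simp [ψ, Zg, g]
  have ea : ∀ l, ψ (Ag l) = fa l := by intro l; simp [ψ, Ag, g]
  have hle : MCon ≤ AddCon.ker ψ := by
    refine AddCon.addConGen_le.2 ?_
    intro u v h
    rw [AddCon.ker_rel]
    rcases h with ⟨rfl, rfl⟩ | ⟨l, rfl, rfl⟩ | ⟨l, rfl, rfl⟩ | ⟨l, rfl, rfl⟩ | ⟨l, rfl, rfl⟩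
    · simp only [map_add, ex, ey, ez, h0]
    · simp only [map_add, ey, ea, ← hy]
    · simp only [map_add, ez, ea, ← hz]
    · simp only [map_add, ex, ey, ← hxy]
    · simp only [map_add, ex, ez, ← hxz]
  exact ⟨MCon.lift ψ hle, ex, ey, ez, ea⟩

theorem MonM_rel {u v : FreeMonM} (h : MRel u v) : MCon.mk' u = MCon.mk' v :=
  (AddCon.eq MCon).2 (AddConGen.Rel.of _ _ h)

theorem MonM_xy (n : ℕ) : xq n + yq n = xq n + zq n := by
  cases n with
  | zero =>
    have := MonM_rel (Or.inl ⟨rfl, rfl⟩)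
    simpa only [map_add, xq, yq, zq] using this
  | succ l =>
    have h1 := MonM_rel (Or.inr (Or.inr (Or.inr (Or.inl ⟨l, rfl, rfl⟩))))
    have h2 := MonM_rel (Or.inr (Or.inr (Or.inr (Or.inr ⟨l, rfl, rfl⟩))))
    have h3 := h1.symm.trans h2
    simpa only [map_add, xq, yq, zq] using h3

theorem MonM_xiy (n i : ℕ) : xq n + i • yq n = xq n + i • zq n := by
  induction i with
  | zero => simp
  | succ i ih =>
    rw [succ_nsmul, succ_nsmul, ← add_assoc, ih, add_right_comm, MonM_xy, add_right_comm, add_assoc]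

theorem MonM_norm (n m i j : ℕ) (hm : 0 < m) :
    m • xq n + i • yq n + j • zq n = m • xq n + (i + j) • zq n := by
  obtain ⟨m, rfl⟩ : ∃ t, m = t + 1 := ⟨m - 1, by omega⟩
  rw [succ_nsmul, add_assoc (m • xq n), MonM_xiy, add_smul]
  abel

/-- Lemma 4.3(b): characterization of equality in `M` between elements written in the
normal form `m x_n + i y_n + j z_n + Σ_{l=1}^n k_l a_l` (here `k l` denotes the
coefficient of `a_{l+1}` for `0 ≤ l < n`). -/
theorem MonM_equality_characterization
    (n m m' i i' j j' : ℕ) (k k' : ℕ → ℕ) :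
    (m • xq n + i • yq n + j • zq n + ∑ l ∈ Finset.range n, k l • aq l
      = m' • xq n + i' • yq n + j' • zq n + ∑ l ∈ Finset.range n, k' l • aq l)
    ↔ ((m = 0 ∧ m' = 0 ∧ i = i' ∧ j = j' ∧ ∀ l < n, k l = k' l)
        ∨ (m = m' ∧ 0 < m ∧ i + j = i' + j' ∧ ∀ l < n, k l = k' l)) := by
  constructor
  · intro h
    have key : ∀ {N : Type} [AddCommMonoid N] (φ : MonM →+ N),
        m • φ (xq n) + i • φ (yq n) + j • φ (zq n) + ∑ l ∈ Finset.range n, k l • φ (aq l)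
        = m' • φ (xq n) + i' • φ (yq n) + j' • φ (zq n)
          + ∑ l ∈ Finset.range n, k' l • φ (aq l) := by
      intro N _ φ
      have := congrArg φ h
      simpa only [map_add, map_nsmul, map_sum] using this
    have hm : m = m' := by
      obtain ⟨φ, hx, hy, hz, ha⟩ := MonM_exists_hom (N := ℕ) (fun _ => 1) (fun _ => 0)
        (fun _ => 0) (fun _ => 0) (by simp) (by simp) (by simp) (by simp) (by simp)
      have := key φ
      simpa [hx, hy, hz, ha] using this
    subst hm
    have hij : i + j = i' + j' := by
      obtain ⟨φ, hx, hy, hz, ha⟩ := MonM_exists_hom (N := ℤ) (fun l => -(l : ℤ)) (fun _ => 1)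
        (fun _ => 1) (fun _ => 0) (by simp) (by simp) (by simp) (by simp) (by simp)
      have := key φ
      simp [hx, hy, hz, ha] at this
      omega
    have hk : ∀ p < n, k p = k' p := by
      intro p hp
      obtain ⟨φ, hx, hy, hz, ha⟩ := MonM_exists_hom (N := ℤ) (fun l => ((l - p : ℕ) : ℤ))
        (fun l => if p < l then -1 else 0) (fun l => if p < l then -1 else 0)
        (fun l => if l = p then 1 else 0) (by simp)
        (by intro l; split_ifs <;> omega)
        (by intro l; split_ifs <;> omega)
        (by intro l; split_ifs <;> omega)
        (by intro l; split_ifs <;> omega)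
      have := key φ
      simp [hx, hy, hz, ha, hp] at this
      omega
    rcases Nat.eq_zero_or_pos m with rfl | hpos
    · left
      have hi : i = i' := by
        obtain ⟨φ, hx, hy, hz, ha⟩ := MonM_exists_hom (N := ℕ∞) (fun _ => ⊤) (fun _ => 1)
          (fun _ => 0) (fun _ => 0) (by simp) (by simp) (by simp) (by simp) (by simp)
        have := key φ
        simpa [hx, hy, hz, ha] using this
      exact ⟨rfl, rfl, hi, by omega, hk⟩
    · exact Or.inr ⟨rfl, hpos, hij, hk⟩
  · have hsum : (∀ l < n, k l = k' l) →
        ∑ l ∈ Finset.range n, k l • aq l = ∑ l ∈ Finset.range n, k' l • aq l := fun hk =>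
      Finset.sum_congr rfl (fun l hl => by rw [hk l (Finset.mem_range.1 hl)])
    rintro (⟨rfl, rfl, rfl, rfl, hk⟩ | ⟨rfl, hpos, hij, hk⟩)
    · rw [hsum hk]
    · rw [hsum hk, MonM_norm n m i j hpos, MonM_norm n m i' j' hpos, hij]
end

section
/- The monoid M presented by generators x0, y0, z0, a1, x1, y1, z1, a2, x2, y2, z2, ... and relations x0 + y0 = x0 + z0, y_l = y_{l+1} + a_{l+1}, z_l = z_{l+1} + a_{l+1}, and x_l = x_{l+1} + y_{l+1} = x_{l+1} + z_{l+1} for all l ≥ 0, is a wild refinement monoid, i.e., M is a refinement monoid that is not tame. -/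
theorem MonM_relY (l : ℕ) : yq l = yq (l + 1) + aq l :=
  (AddCon.eq MCon).2 (AddConGen.Rel.of _ _ (Or.inr (Or.inl ⟨l, rfl, rfl⟩)))

theorem MonM_relZ (l : ℕ) : zq l = zq (l + 1) + aq l :=
  (AddCon.eq MCon).2 (AddConGen.Rel.of _ _ (Or.inr (Or.inr (Or.inl ⟨l, rfl, rfl⟩))))

theorem MonM_relXY (l : ℕ) : xq l = xq (l + 1) + yq (l + 1) :=
  (AddCon.eq MCon).2 (AddConGen.Rel.of _ _ (Or.inr (Or.inr (Or.inr (Or.inl ⟨l, rfl, rfl⟩)))))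

theorem MonM_relXZ (l : ℕ) : xq l = xq (l + 1) + zq (l + 1) :=
  (AddCon.eq MCon).2 (AddConGen.Rel.of _ _ (Or.inr (Or.inr (Or.inr (Or.inr ⟨l, rfl, rfl⟩)))))

theorem MonM_rel0 : xq 0 + yq 0 = xq 0 + zq 0 :=
  (AddCon.eq MCon).2 (AddConGen.Rel.of _ _ (Or.inl ⟨rfl, rfl⟩))

theorem MonM_swap (l : ℕ) : xq l + yq l = xq l + zq l := by
  cases l with
  | zero => exact MonM_rel0
  | succ l => rw [← MonM_relXY, ← MonM_relXZ]

/-- Combinations of the generators `a`. -/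
noncomputable def aComb : (ℕ →₀ ℕ) →+ MonM :=
  Finsupp.liftAddHom (fun k => multiplesHom MonM (aq k))

theorem aComb_single (k n : ℕ) : aComb (Finsupp.single k n) = n • aq k := by
  simp [aComb]

/-- Universal property. -/
theorem MonM_hom {A : Type*} [AddCommMonoid A] (x y z a : ℕ → A)
    (h0 : x 0 + y 0 = x 0 + z 0)
    (hy : ∀ l, y l = y (l + 1) + a l) (hz : ∀ l, z l = z (l + 1) + a l)
    (hxy : ∀ l, x l = x (l + 1) + y (l + 1)) (hxz : ∀ l, x l = x (l + 1) + z (l + 1)) :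
    ∃ φ : MonM →+ A, (∀ l, φ (xq l) = x l) ∧ (∀ l, φ (yq l) = y l) ∧ (∀ l, φ (zq l) = z l) ∧
      (∀ l, φ (aq l) = a l) := by
  let h : FreeGenM → A := Sum.elim (fun p => ![x p.2, y p.2, z p.2] p.1) a
  let F : FreeMonM →+ A := Finsupp.liftAddHom (fun k => multiplesHom A (h k))
  have Fx : ∀ l, F (Xg l) = x l := fun l => by simp [F, Xg, h]
  have Fy : ∀ l, F (Yg l) = y l := fun l => by simp [F, Yg, h]
  have Fz : ∀ l, F (Zg l) = z l := fun l => by simp [F, Zg, h]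
  have Fa : ∀ l, F (Ag l) = a l := fun l => by simp [F, Ag, h]
  have hF : MCon ≤ AddCon.ker F := by
    refine AddCon.addConGen_le.2 ?_
    intro u v huv
    change F u = F v
    rcases huv with ⟨rfl, rfl⟩ | ⟨l, rfl, rfl⟩ | ⟨l, rfl, rfl⟩ | ⟨l, rfl, rfl⟩ | ⟨l, rfl, rfl⟩
    · simp only [map_add, Fx, Fy, Fz, h0]
    · simp only [map_add, Fy, Fa]; exact hy l
    · simp only [map_add, Fz, Fa]; exact hz l
    · simp only [map_add, Fx, Fy]; exact hxy l
    · simp only [map_add, Fx, Fz]; exact hxz l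
  exact ⟨MCon.lift F hF, Fx, Fy, Fz, Fa⟩

/-- Elements of level `l`. -/
noncomputable def lev (l m p q : ℕ) (α : ℕ →₀ ℕ) : MonM :=
  m • xq l + p • yq l + q • zq l + aComb α

theorem lev_add (l m p q m' p' q' : ℕ) (α α' : ℕ →₀ ℕ) :
    lev l m p q α + lev l m' p' q' α' = lev l (m + m') (p + p') (q + q') (α + α') := by
  simp only [lev, map_add, add_smul]
  abel

theorem lev_succ (l m p q : ℕ) (α : ℕ →₀ ℕ) :
    lev l m p q α = lev (l + 1) m (m + p) q (α + Finsupp.single l (p + q)) := by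
  simp only [lev, map_add, aComb_single, add_smul]
  rw [MonM_relXY l, MonM_relY l, MonM_relZ l]
  simp only [nsmul_add]
  abel

theorem lev_descend (l m p q : ℕ) (α : ℕ →₀ ℕ) (n : ℕ) :
    ∃ β, lev l m p q α = lev (l + n) m (m * n + p) q β := by
  induction n with
  | zero => exact ⟨α, by simp⟩
  | succ n ih =>
    obtain ⟨β, hβ⟩ := ih
    refine ⟨β + Finsupp.single (l + n) (m * n + p + q), hβ.trans ((lev_succ _ _ _ _ _).trans ?_)⟩
    · rw [show m + (m * n + p) = m * (n + 1) + p by ring]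
      rfl

theorem lev_swap (l m p q : ℕ) (α : ℕ →₀ ℕ) (hm : m ≠ 0) :
    lev l m p q α = lev l m (p + q) 0 α := by
  obtain ⟨m, rfl⟩ := Nat.exists_eq_succ_of_ne_zero hm
  induction q generalizing p with
  | zero => rfl
  | succ q ih =>
    have : lev l (m + 1) p (q + 1) α = lev l (m + 1) (p + 1) q α := by
      have h := MonM_swap l
      simp only [lev, add_smul, one_smul]
      calc _ = (xq l + zq l) + (m • xq l + p • yq l + q • zq l + aComb α) := by abel
        _ = (xq l + yq l) + (m • xq l + p • yq l + q • zq l + aComb α) := by rw [h]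
        _ = _ := by abel
    rw [Nat.succ_eq_add_one] at *
    rw [this, ih, show p + 1 + q = p + (q + 1) by ring]

theorem lev_eq (l m p q m' p' q' : ℕ) (α α' : ℕ →₀ ℕ) (h1 : m = m') (h2 : p + q = p' + q')
    (h3 : α = α') (h4 : m = 0 → p = p' ∧ q = q') : lev l m p q α = lev l m' p' q' α' := by
  subst h1 h3
  by_cases hm : m = 0
  · obtain ⟨rfl, rfl⟩ := h4 hm; rfl
  · rw [lev_swap _ _ _ _ _ hm, h2, ← lev_swap _ _ _ _ _ hm]

theorem hom_aComb {A : Type*} [AddCommMonoid A] (φ : MonM →+ A) (a : ℕ → A)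
    (h : ∀ l, φ (aq l) = a l) (α : ℕ →₀ ℕ) : φ (aComb α) = α.sum (fun k n => n • a k) := by
  simp [aComb, Finsupp.liftAddHom_apply, Finsupp.sum, h]

theorem lev_inj (l m p q m' p' q' : ℕ) (α α' : ℕ →₀ ℕ)
    (h : lev l m p q α = lev l m' p' q' α') :
    m = m' ∧ p + q = p' + q' ∧ α = α' ∧ (m = 0 → p = p' ∧ q = q') := by
  have hm : m = m' := by
    obtain ⟨φ, hx, hy, hz, ha⟩ := MonM_hom (A := ℕ) (fun _ => 1) (fun _ => 0) (fun _ => 0)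
      (fun _ => 0) rfl (by simp) (by simp) (by simp) (by simp)
    have := congrArg φ h
    simpa [lev, hx, hy, hz, hom_aComb φ _ ha] using this
  subst hm
  have hpq : p + q = p' + q' := by
    obtain ⟨φ, hx, hy, hz, ha⟩ := MonM_hom (A := ℤ) (fun l => -l) (fun _ => 1) (fun _ => 1)
      (fun _ => 0) rfl (by simp) (by simp) (by intro l; push_cast; ring)
      (by intro l; push_cast; ring)
    have := congrArg φ h
    simp [lev, hx, hy, hz, hom_aComb φ _ ha] at this
    omega
  refine ⟨rfl, hpq, ?_, ?_⟩
  · ext k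
    obtain ⟨φ, hx, hy, hz, ha⟩ := MonM_hom (A := ℤ) (fun l => ((l - k : ℕ) : ℤ))
      (fun l => if k < l then -1 else 0) (fun l => if k < l then -1 else 0)
      (fun l => if l = k then 1 else 0) rfl
      (by intro l; split_ifs <;> omega) (by intro l; split_ifs <;> omega)
      (by intro l; split_ifs <;> omega) (by intro l; split_ifs <;> omega)
    have := congrArg φ h
    simp only [lev, map_add, map_nsmul, hx, hy, hz, hom_aComb φ _ ha] at this
    have hs : ∀ γ : ℕ →₀ ℕ, (γ.sum fun j n => n • (if j = k then (1 : ℤ) else 0)) = γ k := by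
      intro γ
      rw [Finsupp.sum]
      simp
      intro h; simp [h]
    rw [hs, hs] at this
    have e : (p : ℤ) + q = p' + q' := by exact_mod_cast hpq
    have e2 : ∀ c : ℤ, (p : ℤ) * c + q * c = p' * c + q' * c := fun c => by
      rw [← add_mul, e, add_mul]
    simp only [nsmul_eq_mul] at this
    have := e2 (if k < l then -1 else 0)
    omega
  · rintro rfl
    constructor
    · obtain ⟨φ, hx, hy, hz, ha⟩ := MonM_hom (A := ℕ∞) (fun _ => ⊤) (fun _ => 1) (fun _ => 0)
        (fun _ => 0) (by simp) (by simp) (by simp) (by simp) (by simp)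
      have := congrArg φ h
      simpa [lev, hx, hy, hz, hom_aComb φ _ ha] using this
    · obtain ⟨φ, hx, hy, hz, ha⟩ := MonM_hom (A := ℕ∞) (fun _ => ⊤) (fun _ => 0) (fun _ => 1)
        (fun _ => 0) (by simp) (by simp) (by simp) (by simp) (by simp)
      have := congrArg φ h
      simpa [lev, hx, hy, hz, hom_aComb φ _ ha] using this

theorem lev_up (u : MonM) (L : ℕ) (h : ∃ m p q α, u = lev L m p q α) (l : ℕ) (hl : L ≤ l) :
    ∃ m p q α, u = lev l m p q α := by
  induction l, hl using Nat.le_induction with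
  | base => exact h
  | succ l hl ih =>
    obtain ⟨m, p, q, α, rfl⟩ := ih
    exact ⟨_, _, _, _, lev_succ _ _ _ _ _⟩

theorem MonM_gen_induction {P : MonM → Prop} (h0 : P 0) (hadd : ∀ u v, P u → P v → P (u + v))
    (hx : ∀ l, P (xq l)) (hy : ∀ l, P (yq l)) (hz : ∀ l, P (zq l)) (ha : ∀ l, P (aq l))
    (u : MonM) : P u := by
  obtain ⟨f, rfl⟩ := AddCon.mk'_surjective (c := MCon) u
  induction f using Finsupp.induction_linear with
  | zero => simpa using h0
  | add f g hf hg => rw [map_add]; exact hadd _ _ hf hg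
  | single k n =>
    have hk : P (MCon.mk' (Finsupp.single k 1)) := by
      rcases k with ⟨i, l⟩ | l
      · fin_cases i
        · exact hx l
        · exact hy l
        · exact hz l
      · exact ha l
    induction n with
    | zero => simpa using h0
    | succ n ih => rw [Finsupp.single_add, map_add]; exact hadd _ _ ih hk

theorem exists_lev (u : MonM) : ∃ L, ∃ m p q α, u = lev L m p q α := by
  induction u using MonM_gen_induction with
  | h0 => exact ⟨0, 0, 0, 0, 0, by simp [lev]⟩
  | hadd u v hu hv =>
    obtain ⟨L, hu⟩ := hu
    obtain ⟨L', hv⟩ := hv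
    obtain ⟨m, p, q, α, rfl⟩ := lev_up u L hu (max L L') (le_max_left _ _)
    obtain ⟨m', p', q', α', rfl⟩ := lev_up v L' hv (max L L') (le_max_right _ _)
    exact ⟨_, _, _, _, _, lev_add _ _ _ _ _ _ _ _ _⟩
  | hx l => exact ⟨l, 1, 0, 0, 0, by simp [lev]⟩
  | hy l => exact ⟨l, 0, 1, 0, 0, by simp [lev]⟩
  | hz l => exact ⟨l, 0, 0, 1, 0, by simp [lev]⟩
  | ha l => exact ⟨l, 0, 0, 0, Finsupp.single l 1, by simp [lev, aComb_single]⟩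

/-- Refinability of one equation. -/
def Refines {M : Type*} [AddCommMonoid M] (x1 x2 y1 y2 : M) : Prop :=
  ∃ z11 z12 z21 z22 : M, x1 = z11 + z12 ∧ x2 = z21 + z22 ∧ y1 = z11 + z21 ∧ y2 = z12 + z22

theorem Refines.left {M : Type*} [AddCommMonoid M] {x1 x2 y1 y2 : M}
    (h : Refines x2 x1 y1 y2) : Refines x1 x2 y1 y2 := by
  obtain ⟨a, b, c, d, h1, h2, h3, h4⟩ := h
  exact ⟨c, d, a, b, h2, h1, by rw [h3, add_comm], by rw [h4, add_comm]⟩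

theorem Refines.swap {M : Type*} [AddCommMonoid M] {x1 x2 y1 y2 : M}
    (h : Refines y1 y2 x1 x2) : Refines x1 x2 y1 y2 := by
  obtain ⟨a, b, c, d, h1, h2, h3, h4⟩ := h
  exact ⟨a, c, b, d, h3, h4, h1, h2⟩

theorem Refines.right {M : Type*} [AddCommMonoid M] {x1 x2 y1 y2 : M}
    (h : Refines x1 x2 y2 y1) : Refines x1 x2 y1 y2 := h.swap.left.swap

theorem nat_refines (a b c d : ℕ) (h : a + b = c + d) : Refines a b c d :=
  ⟨min a c, a - min a c, c - min a c, d - (a - min a c), by omega, by omega, by omega, by omega⟩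

theorem finsupp_refines (a b c d : ℕ →₀ ℕ) (h : a + b = c + d) : Refines a b c d := by
  have h' : ∀ k, a k + b k = c k + d k := fun k => DFunLike.congr_fun h k
  refine ⟨a ⊓ c, a - a ⊓ c, c - a ⊓ c, d - (a - a ⊓ c), ?_, ?_, ?_, ?_⟩ <;> ext k <;>
    have := h' k <;> simp <;> omega

section cases

variable (l m1 p1 q1 m2 p2 q2 n1 r1 s1 n2 r2 s2 : ℕ) (α1 α2 β1 β2 : ℕ →₀ ℕ)

theorem refine_free (h : lev l m1 p1 q1 α1 + lev l m2 p2 q2 α2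
      = lev l n1 r1 s1 β1 + lev l n2 r2 s2 β2) (hm1 : m1 = 0) (hm2 : m2 = 0) :
    Refines (lev l m1 p1 q1 α1) (lev l m2 p2 q2 α2) (lev l n1 r1 s1 β1) (lev l n2 r2 s2 β2) := by
  rw [lev_add, lev_add] at h
  obtain ⟨h1, h2, h3, h4⟩ := lev_inj _ _ _ _ _ _ _ _ _ h
  obtain ⟨h5, h6⟩ := h4 (by omega)
  obtain ⟨a, b, c, d, ha, hb, hc, hd⟩ := finsupp_refines _ _ _ _ h3
  obtain ⟨t1, t2, t3, t4, ga, gb, gc, gd⟩ := nat_refines _ _ _ _ h5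
  obtain ⟨u1, u2, u3, u4, ka, kb, kc, kd⟩ := nat_refines _ _ _ _ h6
  refine ⟨lev l 0 t1 u1 a, lev l 0 t2 u2 b, lev l 0 t3 u3 c, lev l 0 t4 u4 d,
    ?_, ?_, ?_, ?_⟩ <;> rw [lev_add] <;> apply lev_eq <;> first | assumption | omega

theorem refine_pos (h : lev l m1 p1 q1 α1 + lev l m2 p2 q2 α2
      = lev l n1 r1 s1 β1 + lev l n2 r2 s2 β2) (hm1 : m1 ≠ 0) (hm2 : m2 ≠ 0)
      (hn1 : n1 ≠ 0) (hn2 : n2 ≠ 0) :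
    Refines (lev l m1 p1 q1 α1) (lev l m2 p2 q2 α2) (lev l n1 r1 s1 β1) (lev l n2 r2 s2 β2) := by
  rw [lev_add, lev_add] at h
  obtain ⟨h1, h2, h3, h4⟩ := lev_inj _ _ _ _ _ _ _ _ _ h
  obtain ⟨a, b, c, d, ha, hb, hc, hd⟩ := finsupp_refines _ _ _ _ h3
  obtain ⟨t1, t2, t3, t4, ga, gb, gc, gd⟩ :=
    nat_refines (p1 + q1) (p2 + q2) (r1 + s1) (r2 + s2) (by omega)
  obtain ⟨u1, u2, u3, u4, ka, kb, kc, kd⟩ := nat_refines _ _ _ _ h1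
  refine ⟨lev l u1 t1 0 a, lev l u2 t2 0 b, lev l u3 t3 0 c, lev l u4 t4 0 d,
    ?_, ?_, ?_, ?_⟩ <;> rw [lev_add] <;> apply lev_eq <;> first | assumption | omega

theorem refine_one (h : lev l m1 p1 q1 α1 + lev l m2 p2 q2 α2
      = lev l n1 r1 s1 β1 + lev l n2 r2 s2 β2) (hm1 : m1 = 0)
      (hn1 : n1 ≠ 0) (hn2 : n2 ≠ 0) :
    Refines (lev l m1 p1 q1 α1) (lev l m2 p2 q2 α2) (lev l n1 r1 s1 β1) (lev l n2 r2 s2 β2) := by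
  rw [lev_add, lev_add] at h
  obtain ⟨h1, h2, h3, h4⟩ := lev_inj _ _ _ _ _ _ _ _ _ h
  obtain ⟨a, b, c, d, ha, hb, hc, hd⟩ := finsupp_refines _ _ _ _ h3
  obtain ⟨t1, t2, t3, t4, ga, gb, gc, gd⟩ :=
    nat_refines (p1 + q1) (p2 + q2) (r1 + s1) (r2 + s2) (by omega)
  obtain ⟨i, j, i', j', ka, kb, kc, kd⟩ := nat_refines p1 q1 t1 t2 ga
  refine ⟨lev l 0 i i' a, lev l 0 j j' b, lev l n1 t3 0 c, lev l n2 t4 0 d,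
    ?_, ?_, ?_, ?_⟩ <;> rw [lev_add] <;> apply lev_eq <;> first | assumption | omega

theorem refine_two_aux (h : lev l m1 p1 q1 α1 + lev l m2 p2 q2 α2
      = lev l n1 r1 s1 β1 + lev l n2 r2 s2 β2) (hm1 : m1 = 0) (hm2 : m2 ≠ 0)
      (hn1 : n1 = 0) (hbig : r1 + s1 ≤ p2 + q2) :
    Refines (lev l m1 p1 q1 α1) (lev l m2 p2 q2 α2) (lev l n1 r1 s1 β1) (lev l n2 r2 s2 β2) := by
  rw [lev_add, lev_add] at h
  obtain ⟨h1, h2, h3, h4⟩ := lev_inj _ _ _ _ _ _ _ _ _ h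
  obtain ⟨a, b, c, d, ha, hb, hc, hd⟩ := finsupp_refines _ _ _ _ h3
  refine ⟨lev l 0 0 0 a, lev l 0 p1 q1 b, lev l 0 r1 s1 c, lev l m2 (p2 + q2 - (r1 + s1)) 0 d,
    ?_, ?_, ?_, ?_⟩ <;> rw [lev_add] <;> apply lev_eq <;> first | assumption | omega

theorem refine_two (h : lev l m1 p1 q1 α1 + lev l m2 p2 q2 α2
      = lev l n1 r1 s1 β1 + lev l n2 r2 s2 β2) (hm1 : m1 = 0) (hm2 : m2 ≠ 0)
      (hn1 : n1 = 0) :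
    Refines (lev l m1 p1 q1 α1) (lev l m2 p2 q2 α2) (lev l n1 r1 s1 β1) (lev l n2 r2 s2 β2) := by
  obtain ⟨_, e1⟩ := lev_descend l m1 p1 q1 α1 (r1 + s1)
  obtain ⟨_, e2⟩ := lev_descend l m2 p2 q2 α2 (r1 + s1)
  obtain ⟨_, e3⟩ := lev_descend l n1 r1 s1 β1 (r1 + s1)
  obtain ⟨_, e4⟩ := lev_descend l n2 r2 s2 β2 (r1 + s1)
  rw [e1, e2, e3, e4] at h ⊢
  apply refine_two_aux _ _ _ _ _ _ _ _ _ _ _ _ _ _ _ _ _ h hm1 hm2 hn1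
  subst hn1
  have := Nat.le_mul_of_pos_left (r1 + s1) (Nat.pos_of_ne_zero hm2)
  omega

theorem refine_all (h : lev l m1 p1 q1 α1 + lev l m2 p2 q2 α2
      = lev l n1 r1 s1 β1 + lev l n2 r2 s2 β2) :
    Refines (lev l m1 p1 q1 α1) (lev l m2 p2 q2 α2) (lev l n1 r1 s1 β1) (lev l n2 r2 s2 β2) := by
  have hl := (add_comm _ _).trans h
  have hr := h.trans (add_comm _ _)
  have hlr := hl.trans (add_comm _ _)
  have hmn : m1 + m2 = n1 + n2 := by
    have h' := h
    rw [lev_add, lev_add] at h'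
    exact (lev_inj _ _ _ _ _ _ _ _ _ h').1
  by_cases hm1 : m1 = 0 <;> by_cases hm2 : m2 = 0
  · exact refine_free _ _ _ _ _ _ _ _ _ _ _ _ _ _ _ _ _ h hm1 hm2
  · by_cases hn1 : n1 = 0
    · exact refine_two _ _ _ _ _ _ _ _ _ _ _ _ _ _ _ _ _ h hm1 hm2 hn1
    · by_cases hn2 : n2 = 0
      · exact (refine_two _ _ _ _ _ _ _ _ _ _ _ _ _ _ _ _ _ hr hm1 hm2 hn2).right
      · exact refine_one _ _ _ _ _ _ _ _ _ _ _ _ _ _ _ _ _ h hm1 hn1 hn2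
  · by_cases hn1 : n1 = 0
    · exact (refine_two _ _ _ _ _ _ _ _ _ _ _ _ _ _ _ _ _ hl hm2 hm1 hn1).left
    · by_cases hn2 : n2 = 0
      · exact (refine_two _ _ _ _ _ _ _ _ _ _ _ _ _ _ _ _ _ hlr hm2 hm1 hn2).right.left
      · exact (refine_one _ _ _ _ _ _ _ _ _ _ _ _ _ _ _ _ _ hl hm2 hn1 hn2).left
  · by_cases hn1 : n1 = 0
    · exact (refine_one _ _ _ _ _ _ _ _ _ _ _ _ _ _ _ _ _ h.symm hn1 hm1 hm2).swap
    · by_cases hn2 : n2 = 0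
      · exact (refine_one _ _ _ _ _ _ _ _ _ _ _ _ _ _ _ _ _ hr.symm hn2 hm1 hm2).swap.right
      · exact refine_pos _ _ _ _ _ _ _ _ _ _ _ _ _ _ _ _ _ h hm1 hm2 hn1 hn2

end cases

theorem MonM_refinement : IsRefinementAddMonoid MonM := by
  intro x1 x2 y1 y2 h
  obtain ⟨l1, e1⟩ := exists_lev x1
  obtain ⟨l2, e2⟩ := exists_lev x2
  obtain ⟨l3, e3⟩ := exists_lev y1
  obtain ⟨l4, e4⟩ := exists_lev y2
  obtain ⟨m1, p1, q1, a1, rfl⟩ := lev_up _ _ e1 (l1 + l2 + l3 + l4) (by omega)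
  obtain ⟨m2, p2, q2, a2, rfl⟩ := lev_up _ _ e2 (l1 + l2 + l3 + l4) (by omega)
  obtain ⟨m3, p3, q3, a3, rfl⟩ := lev_up _ _ e3 (l1 + l2 + l3 + l4) (by omega)
  obtain ⟨m4, p4, q4, a4, rfl⟩ := lev_up _ _ e4 (l1 + l2 + l3 + l4) (by omega)
  exact refine_all _ _ _ _ _ _ _ _ _ _ _ _ _ _ _ _ _ h

theorem MonM_state : ∃ φ : MonM →+ ℚ, ∀ u, 0 ≤ φ u ∧ (φ u = 0 → u = 0) := by
  have hh : ∀ l : ℕ, ((1 : ℚ) / 2) ^ l = (1 / 2) ^ (l + 1) + (1 / 2) ^ (l + 1) := by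
    intro l; ring
  obtain ⟨φ, hx, hy, hz, ha⟩ := MonM_hom (A := ℚ) (fun l => (1 / 2) ^ l) (fun l => (1 / 2) ^ l)
    (fun l => (1 / 2) ^ l) (fun l => (1 / 2) ^ (l + 1)) rfl hh hh hh hh
  refine ⟨φ, fun u => ?_⟩
  have pos : ∀ v, 0 < φ v → 0 ≤ φ v ∧ (φ v = 0 → v = 0) := fun v hv =>
    ⟨hv.le, fun h => absurd h hv.ne'⟩
  induction u using MonM_gen_induction with
  | h0 => simp
  | hadd u v hu hv =>
    rw [map_add]
    refine ⟨add_nonneg hu.1 hv.1, fun h => ?_⟩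
    rw [hu.2 (by linarith [hu.1, hv.1]), hv.2 (by linarith [hu.1, hv.1]), add_zero]
  | hx l => apply pos; rw [hx]; positivity
  | hy l => apply pos; rw [hy]; positivity
  | hz l => apply pos; rw [hz]; positivity
  | ha l => apply pos; rw [ha]; positivity

theorem MonM_absorb (x u v w : MonM) (h : x + (u + v + w) = x) : u = 0 := by
  obtain ⟨φ, hφ⟩ := MonM_state
  have := congrArg φ h
  simp only [map_add] at this
  exact (hφ u).2 (by linarith [(hφ u).1, (hφ v).1, (hφ w).1])

theorem yq_ne_zq : yq 0 ≠ zq 0 := by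
  intro h
  have := lev_inj 0 0 1 0 0 0 1 0 0 (by simpa [lev] using h)
  simp at this

theorem fg_wqo {N : Type*} [AddCommMonoid N] (hN : AddMonoid.FG N) (x : ℕ → N) :
    ∃ i j, i < j ∧ ∃ t, x j = x i + t := by
  obtain ⟨S, hS⟩ := hN.fg_top
  have hex : ∀ n : ℕ, ∃ a : S → ℕ, x n = ∑ i, a i • (i : N) := by
    intro n
    rw [← AddSubmonoid.mem_closure_range_iff_of_fintype, Subtype.range_coe]
    have : x n ∈ (⊤ : AddSubmonoid N) := trivial
    rw [← hS] at this
    exact this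
  choose a ha using hex
  obtain ⟨i, j, hij, hle⟩ := wellQuasiOrdered_le a
  refine ⟨i, j, hij, ∑ s, (a j s - a i s) • (s : N), ?_⟩
  rw [ha, ha, ← Finset.sum_add_distrib]
  refine Finset.sum_congr rfl fun s _ => ?_
  rw [← add_smul, Nat.add_sub_of_le (hle s)]

/-- Iterated refinement of `x + y = x + z`. -/
theorem iter_refine {N : Type*} [AddCommMonoid N] (hN : IsRefinementAddMonoid N) (x y z : N)
    (h : x + y = x + z) :
    ∃ X Y Z A : ℕ → N, X 0 = x ∧
      (∀ l, y = Y l + A l ∧ z = Z l + A l) ∧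
      (∀ l, X l = X (l + 1) + Y (l + 1) ∧ X l = X (l + 1) + Z (l + 1)) := by
  let T := {t : N × N × N × N // t.1 + t.2.1 = t.1 + t.2.2.1 ∧ y = t.2.1 + t.2.2.2 ∧
    z = t.2.2.1 + t.2.2.2}
  have step : ∀ t : T, ∃ t' : T, t.1.1 = t'.1.1 + t'.1.2.1 ∧ t.1.1 = t'.1.1 + t'.1.2.2.1 := by
    rintro ⟨⟨x', y', z', a'⟩, h1, h2, h3⟩
    dsimp only at h1 h2 h3
    obtain ⟨p, q, r, s, e1, e2, e3, e4⟩ := hN _ _ _ _ h1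
    refine ⟨⟨(p, r, q, s + a'), ?_, ?_, ?_⟩, e3, e1⟩
    · exact e3.symm.trans e1
    · dsimp only; rw [h2, e2, add_assoc]
    · dsimp only; rw [h3, e4, add_assoc]
  choose F hF using step
  let t0 : T := ⟨(x, y, z, 0), h, (add_zero _).symm, (add_zero _).symm⟩
  let t : ℕ → T := fun n => F^[n] t0
  refine ⟨fun n => (t n).1.1, fun n => (t n).1.2.1, fun n => (t n).1.2.2.1,
    fun n => (t n).1.2.2.2, rfl, fun l => (t l).2.2, fun l => ?_⟩
  have : t (l + 1) = F (t l) := Function.iterate_succ_apply' F l t0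
  simp only [this]
  exact hF (t l)

theorem chain_sum {N : Type*} [AddCommMonoid N] (X Y : ℕ → N)
    (h : ∀ l, X l = X (l + 1) + Y (l + 1)) (i d : ℕ) :
    ∃ w, X i = X (i + d + 1) + (Y (i + d + 1) + w) := by
  induction d with
  | zero => exact ⟨0, by rw [add_zero (Y _)]; exact h i⟩
  | succ d ih =>
    obtain ⟨w, hw⟩ := ih
    refine ⟨Y (i + d + 1) + w, ?_⟩
    rw [hw, h (i + d + 1)]
    simp only [add_assoc]

theorem chain_zero (N : Type*) [AddCommMonoid N] (g : N →+ MonM) (X Y : ℕ → N)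
    (h : ∀ l, X l = X (l + 1) + Y (l + 1)) (i j : ℕ) (hij : i < j) (t : N)
    (ht : X j = X i + t) : g (Y j) = 0 := by
  obtain ⟨d, rfl⟩ := Nat.exists_eq_add_of_lt hij
  obtain ⟨w, hw⟩ := chain_sum X Y h i d
  apply MonM_absorb (g (X i)) _ (g w) (g t)
  rw [← map_add, ← map_add, ← map_add]
  congr 1
  conv_rhs => rw [hw, ht]
  abel

theorem MonM_not_tame : ¬ IsTame MonM := by
  intro hT
  let S : AddSubmonoid MonM := AddSubmonoid.closure {xq 0, yq 0, zq 0}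
  have hx : xq 0 ∈ S := AddSubmonoid.subset_closure (by simp)
  have hy : yq 0 ∈ S := AddSubmonoid.subset_closure (by simp)
  have hz : zq 0 ∈ S := AddSubmonoid.subset_closure (by simp)
  have hfg : S.FG := (AddSubmonoid.fg_iff _).2 ⟨_, rfl, by simp⟩
  obtain ⟨N, fg, ref, f, g, fac⟩ := hT S hfg
  have hrel : f ⟨_, hx⟩ + f ⟨_, hy⟩ = f ⟨_, hx⟩ + f ⟨_, hz⟩ := by
    rw [← map_add, ← map_add]
    congr 1
    exact Subtype.ext MonM_rel0
  obtain ⟨X, Y, Z, A, -, hYZ, hX⟩ := iter_refine ref _ _ _ hrel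
  obtain ⟨i, j, hij, t, ht⟩ := fg_wqo fg X
  have gy := chain_zero N g X Y (fun l => (hX l).1) i j hij t ht
  have gz := chain_zero N g X Z (fun l => (hX l).2) i j hij t ht
  apply yq_ne_zq
  have ey := fac ⟨_, hy⟩
  have ez := fac ⟨_, hz⟩
  rw [(hYZ j).1, map_add, gy] at ey
  rw [(hYZ j).2, map_add, gz] at ez
  exact ey.symm.trans ez

/-- The monoid `M` is a wild refinement monoid: it has refinement but is not tame. -/
theorem MonM_wild : IsRefinementAddMonoid MonM ∧ ¬ IsTame MonM := by
  exact ⟨MonM_refinement, MonM_not_tame⟩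
end
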